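/- Suppose the language L is countable. Then covering independence ⫝c has small local character: for all subsets A, B of M and every C₀ ⊆ B with #C₀ ≤ #A + ℵ₀, there exists a set C with C₀ ⊆ C ⊆ B, #C ≤ #A + ℵ₀, and A ⫝c_C B. -/

import Mathlib

open FirstOrder Cardinal

/-- Covering independence: `A ⫝c_C B` ("`C` covers `A` in `B`") in the `L`-structure `M`. -/
def IndC (L : Language) (M : Type*) [L.Structure M] (A C B : Set M) : Prop :=
  ∀ (k m n : ℕ) (φ : L.Formula (Fin k ⊕ Fin m ⊕ Fin n))
    (a : Fin k → M) (b : Fin m → M) (c : Fin n → M),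
    (∀ i, a i ∈ A) → (∀ i, b i ∈ B) → (∀ i, c i ∈ C) →
    ∃ d : Fin m → M, (∀ i, d i ∈ C) ∧
      (φ.Realize (Sum.elim a (Sum.elim b c)) → φ.Realize (Sum.elim a (Sum.elim d c)))

universe u v w

namespace CoveringSkolem

/-- A choice of tuple from `B` realizing `φ` over the given parameters, whenever there is one. -/
theorem exists_witness {L : FirstOrder.Language.{u, v}} {M : Type w} [L.Structure M] {B : Set M}
    (hB : B.Nonempty) {k m n : ℕ} (φ : L.Formula (Fin k ⊕ Fin m ⊕ Fin n))
    (a : Fin k → M) (c : Fin n → M) :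
    ∃ d : Fin m → B, ∀ b : Fin m → B,
      φ.Realize (Sum.elim a (Sum.elim (fun i => (b i : M)) c)) →
        φ.Realize (Sum.elim a (Sum.elim (fun i => (d i : M)) c)) := by
  by_cases h : ∃ b : Fin m → B, φ.Realize (Sum.elim a (Sum.elim (fun i => (b i : M)) c))
  · obtain ⟨d, hd⟩ := h
    exact ⟨d, fun _ _ => hd⟩
  · exact ⟨fun _ => ⟨hB.some, hB.some_mem⟩, fun b hb => (h ⟨b, hb⟩).elim⟩

/-- The `n`-ary Skolem functions: one for each formula with `n` designated variables, each
coordinate of the tuple to be witnessed, and each tuple of parameters from `A`. -/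
def skolemLanguage (L : FirstOrder.Language.{u, v}) {M : Type w} (A : Set M) :
    FirstOrder.Language.{max u v w, 0} where
  Functions n := Σ k : ℕ, Σ m : ℕ, (L.Formula (Fin k ⊕ Fin m ⊕ Fin n) × Fin m) × (Fin k → A)
  Relations _ := Empty

/-- The interpretation in `B` of the Skolem functions by chosen witnesses. -/
@[reducible]
noncomputable def skolemStructure (L : FirstOrder.Language.{u, v}) {M : Type w} [L.Structure M]
    (A : Set M) {B : Set M} (hB : B.Nonempty) : (skolemLanguage L A).Structure B where
  funMap := fun ⟨_, _, ⟨φ, i⟩, a⟩ c =>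
    (exists_witness hB φ (fun j => (a j : M)) (fun j => (c j : M))).choose i
  RelMap r _ := r.elim

theorem card_skolemFunctions_le (L : FirstOrder.Language.{u, v}) [Countable L.Symbols]
    {M : Type w} (A : Set M) :
    #(Σ n, (skolemLanguage L A).Functions n) ≤ lift.{max u v} (#A + ℵ₀) := by
  let Q := Σ n : ℕ, Σ k : ℕ, Σ m : ℕ, (L.Formula (Fin k ⊕ Fin m ⊕ Fin n) × Fin m)
  have hQ : #Q ≤ ℵ₀ := mk_le_aleph0
  let f : (Σ n, (skolemLanguage L A).Functions n) → Q × List A :=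
    fun ⟨n, k, m, p, a⟩ => (⟨n, k, m, p⟩, List.ofFn a)
  have hf : Function.Injective f := by
    rintro ⟨n, k, m, p, a⟩ ⟨n', k', m', p', a'⟩ h
    obtain ⟨h₁, h₂⟩ := Prod.mk.inj h
    cases h₁
    cases List.ofFn_injective h₂
    rfl
  have hle : lift.{max u v} #(List A) ≤ lift.{max u v} (#A + ℵ₀) := by
    rw [lift_le, add_comm, add_eq_max le_rfl]
    exact mk_list_le_max A
  have hinf : ℵ₀ ≤ lift.{max u v} (#A + ℵ₀) := by
    rw [aleph0_le_lift]; exact self_le_add_left _ _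
  refine (mk_le_of_injective hf).trans ?_
  rw [mk_prod]
  refine (mul_le_mul' (lift_le_aleph0.2 hQ) hle).trans ?_
  exact (aleph0_mul_eq hinf).le

theorem card_closure_le (L : FirstOrder.Language.{u, v}) [Countable L.Symbols] {M : Type w}
    (A : Set M) {B : Set M} [(skolemLanguage L A).Structure B] (s : Set B)
    (hs : #s ≤ #A + ℵ₀) :
    #(Language.Substructure.closure (skolemLanguage L A) s) ≤ #A + ℵ₀ := by
  have hinf : ℵ₀ ≤ #A + ℵ₀ := self_le_add_left _ _
  have hfun := card_skolemFunctions_le.{u, v, w} L A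
  have h := Language.Substructure.lift_card_closure_le.{max u v w, 0, w}
    (L := skolemLanguage L A) (s := s)
  rw [lift_id'.{w, max u v w}] at h
  rw [← lift_le.{max u v w, w}]
  refine h.trans (max_le (aleph0_le_lift.2 hinf) ?_)
  rw [lift_umax.{w, max u v}]
  refine (add_le_add (lift_le.2 hs) hfun).trans ?_
  exact (add_eq_self (aleph0_le_lift.2 hinf)).le

end CoveringSkolem

theorem stmt16 (L : Language) (M : Type*) [L.Structure M] [Countable L.Symbols] :
    ∀ A B C₀ : Set M, C₀ ⊆ B → #C₀ ≤ #A + ℵ₀ →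
      ∃ C : Set M, C₀ ⊆ C ∧ C ⊆ B ∧ #C ≤ #A + ℵ₀ ∧ IndC L M A C B := by
  intro A B C₀ hC₀ hcard
  rcases B.eq_empty_or_nonempty with rfl | hB
  · exact ⟨C₀, subset_rfl, hC₀, hcard, fun k m n φ a b c _ hb _ =>
      ⟨b, fun i => (hb i).elim, id⟩⟩
  let := CoveringSkolem.skolemStructure L A hB
  let S : (CoveringSkolem.skolemLanguage L A).Substructure B :=
    Language.Substructure.closure _ (Subtype.val ⁻¹' C₀)
  refine ⟨Subtype.val '' (S : Set B), ?_, ?_, ?_, ?_⟩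
  · exact fun x hx => ⟨⟨x, hC₀ hx⟩, Language.Substructure.subset_closure hx, rfl⟩
  · rintro _ ⟨x, -, rfl⟩
    exact x.2
  · exact mk_image_le.trans <| CoveringSkolem.card_closure_le L A _ <|
      (mk_preimage_of_injective _ _ Subtype.val_injective).trans hcard
  · intro k m n φ a b c ha hb hc
    choose c' hc' hcc' using hc
    obtain rfl : (fun i => (c' i : M)) = c := funext hcc'
    have hw := (CoveringSkolem.exists_witness hB φ a (fun j => (c' j : M))).choose_spec
      (fun i => ⟨b i, hb i⟩)
    refine ⟨_, fun i => ⟨_, ?_, rfl⟩, hw⟩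
    exact S.fun_mem (n := n) ⟨k, m, ⟨φ, i⟩, fun j => ⟨a j, ha j⟩⟩ c' hc'
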